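/- Let n ∈ ℕ^d with all entries positive and let 1 ≤ i ≤ d. For the function f_i(x) = φ_{ℓ_i,2n_i}(x_i) ∏_{j≠i} φ_{ℓ_j,0}(x_j), the tensor product scaled Gauss–Hermite rule satisfies I_α(f_i) − Q_{α,ℓ,n}^{GH}(f_i) = C_{n_i} [∏_{j=1}^d (β_j/α_j)] (β_i²/(2ℓ_i²))^{n_i} n_i^{1/4}, where β_j = α_jℓ_j/√(α_j² + ℓ_j²). -/

import Mathlib

open MeasureTheory Real Filter

noncomputable section

/-- The orthonormal basis functions of the Gaussian RKHS. -/
def phi (ℓ : ℝ) (m : ℕ) (x : ℝ) : ℝ :=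
  x ^ m * Real.exp (-x ^ 2 / (2 * ℓ ^ 2)) / (ℓ ^ m * Real.sqrt (Nat.factorial m))

/-- The univariate Gaussian integral functional. -/
def Igauss (α : ℝ) (f : ℝ → ℝ) : ℝ :=
  (Real.sqrt (2 * Real.pi) * α)⁻¹ * ∫ x : ℝ, f x * Real.exp (-x ^ 2 / (2 * α ^ 2))

/-- β = αℓ/√(α² + ℓ²). -/
def betaP (α ℓ : ℝ) : ℝ := α * ℓ / Real.sqrt (α ^ 2 + ℓ ^ 2)

/-- C_n = 2^n n! n^{−1/4} / √((2n)!). -/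
def Cseq (n : ℕ) : ℝ :=
  2 ^ n * (Nat.factorial n : ℝ) * (n : ℝ) ^ (-(1 / 4 : ℝ)) / Real.sqrt (Nat.factorial (2 * n))

/-- ω_γ = 2γ²/(1 + 2γ² + √(1+4γ²)). -/
def omegaP (γ : ℝ) : ℝ := 2 * γ ^ 2 / (1 + 2 * γ ^ 2 + Real.sqrt (1 + 4 * γ ^ 2))

/-- C̄_n(γ). -/
def Cbar (γ : ℝ) (n : ℕ) : ℝ :=
  Real.sqrt (2 * (1 + 4 * γ ^ 2) ^ ((1 : ℝ) / 4) /
      ((1 + 2 * γ ^ 2 + Real.sqrt (1 + 4 * γ ^ 2)) * Real.exp 1)) *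
    ((Nat.factorial n : ℝ) / (Nat.factorial (2 * n) : ℝ)) *
    (Real.exp 1 / (4 * (n : ℝ))) ^ (-(n : ℤ))

/-- `x`, `w` are the nodes and weights of the n-point Gauss–Hermite rule: the nodes are the
n distinct roots of the probabilists' Hermite polynomial H_n, the weights are positive, and
the rule integrates exactly all polynomials of degree at most 2n−1 against the standard
Gaussian weight. -/
def IsGaussHermite (n : ℕ) (x w : Fin n → ℝ) : Prop :=
  Function.Injective x ∧
  (∀ i, Polynomial.aeval (x i) (Polynomial.hermite n) = 0) ∧
  (∀ i, 0 < w i) ∧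
  ∀ p : Polynomial ℝ, p.natDegree ≤ 2 * n - 1 →
    ∑ i, w i * p.eval (x i)
      = (Real.sqrt (2 * Real.pi))⁻¹ * ∫ t : ℝ, p.eval t * Real.exp (-t ^ 2 / 2)

/-- The scaled Gauss–Hermite rule Q_{α,ℓ,n}^{GH}. -/
def QGH (α ℓ : ℝ) {n : ℕ} (x w : Fin n → ℝ) (f : ℝ → ℝ) : ℝ :=
  betaP α ℓ / α *
    ∑ i, w i * Real.exp (betaP α ℓ ^ 2 * x i ^ 2 / (2 * ℓ ^ 2)) * f (betaP α ℓ * x i)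

/-- Membership in the unit ball of the Gaussian RKHS H(K_ℓ). -/
def InBall (ℓ : ℝ) (f : ℝ → ℝ) : Prop :=
  ∃ c : ℕ → ℝ, (∀ x, HasSum (fun m => c m * phi ℓ m x) (f x)) ∧
    Summable (fun m => c m ^ 2) ∧ (∑' m, c m ^ 2) ≤ 1

/-- Worst-case error of a quadrature functional over the unit ball of H(K_ℓ). -/
def wce1 (α ℓ : ℝ) (Q : (ℝ → ℝ) → ℝ) : ℝ :=
  sSup {e : ℝ | ∃ f : ℝ → ℝ, InBall ℓ f ∧ e = |Igauss α f - Q f|}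

/-- The n-th minimal worst-case error (univariate). -/
def minErr1 (α ℓ : ℝ) (n : ℕ) : ℝ :=
  ⨅ p : (Fin n → ℝ) × (Fin n → ℝ), wce1 α ℓ fun f => ∑ i, p.2 i * f (p.1 i)

/-- The multivariate Gaussian integral functional. -/
def IgaussD {d : ℕ} (α : Fin d → ℝ) (f : (Fin d → ℝ) → ℝ) : ℝ :=
  ∫ x : Fin d → ℝ,
    f x * ∏ i, (Real.sqrt (2 * Real.pi) * α i)⁻¹ * Real.exp (-(x i) ^ 2 / (2 * α i ^ 2))

/-- Membership in the unit ball of the tensor-product Gaussian RKHS H(K_ℓ), ℓ ∈ ℝ^d. -/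
def InBallD {d : ℕ} (ℓ : Fin d → ℝ) (f : (Fin d → ℝ) → ℝ) : Prop :=
  ∃ c : (Fin d → ℕ) → ℝ,
    (∀ x, HasSum (fun m => c m * ∏ i, phi (ℓ i) (m i) (x i)) (f x)) ∧
    Summable (fun m => c m ^ 2) ∧ (∑' m, c m ^ 2) ≤ 1

/-- Worst-case error of a multivariate quadrature functional. -/
def wceD {d : ℕ} (α ℓ : Fin d → ℝ) (Q : ((Fin d → ℝ) → ℝ) → ℝ) : ℝ :=
  sSup {e : ℝ | ∃ f, InBallD ℓ f ∧ e = |IgaussD α f - Q f|}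

/-- The N-th minimal worst-case error in dimension d. -/
def minErrD {d : ℕ} (α ℓ : Fin d → ℝ) (N : ℕ) : ℝ :=
  ⨅ p : (Fin N → (Fin d → ℝ)) × (Fin N → ℝ), wceD α ℓ fun f => ∑ i, p.2 i * f (p.1 i)

/-- The tensor-product scaled Gauss–Hermite rule. -/
def QGHD {d : ℕ} (α ℓ : Fin d → ℝ) (n : Fin d → ℕ)
    (x w : ∀ j, Fin (n j) → ℝ) (f : (Fin d → ℝ) → ℝ) : ℝ :=
  ∑ i : ∀ j, Fin (n j),
    (∏ j, betaP (α j) (ℓ j) / α j * w j (i j) *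
        Real.exp (betaP (α j) (ℓ j) ^ 2 * x j (i j) ^ 2 / (2 * ℓ j ^ 2))) *
      f fun j => betaP (α j) (ℓ j) * x j (i j)

/-- The power function of a finite point set (univariate). -/
def power1 (ℓ : ℝ) (X : Finset ℝ) (x : ℝ) : ℝ :=
  sSup {v : ℝ | ∃ f, InBall ℓ f ∧ (∀ y ∈ X, f y = 0) ∧ v = f x}

/-- Fill distance of X on Ω (univariate). -/
def fillDist1 (X : Finset ℝ) (Ω : Set ℝ) : ℝ :=
  sSup {h : ℝ | ∃ x ∈ Ω, h = sInf {r : ℝ | ∃ y ∈ X, y ∈ Ω ∧ r = |x - y|}}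

/-- Euclidean distance on ℝ^d. -/
def eucDist {d : ℕ} (x y : Fin d → ℝ) : ℝ := Real.sqrt (∑ i, (x i - y i) ^ 2)

/-- The power function of a finite point set in ℝ^d for the isotropic Gaussian kernel. -/
def powerD {d : ℕ} (ℓ : ℝ) (X : Finset (Fin d → ℝ)) (x : Fin d → ℝ) : ℝ :=
  sSup {v : ℝ | ∃ f, InBallD (fun _ => ℓ) f ∧ (∀ y ∈ X, f y = 0) ∧ v = f x}

/-- Fill distance of X on Ω ⊂ ℝ^d (Euclidean). -/
def fillDistD {d : ℕ} (X : Finset (Fin d → ℝ)) (Ω : Set (Fin d → ℝ)) : ℝ :=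
  sSup {h : ℝ | ∃ x ∈ Ω, h = sInf {r : ℝ | ∃ y ∈ X, y ∈ Ω ∧ r = eucDist x y}}

/-- Worst-case error of the optimal-weight (kernel quadrature) rule with nodes X (univariate). -/
def eopt1 (α ℓ : ℝ) (X : Finset ℝ) : ℝ :=
  ⨅ w : ℝ → ℝ, wce1 α ℓ fun f => ∑ y ∈ X, w y * f y

/-- Worst-case error of the optimal-weight rule with nodes X ⊂ ℝ^d. -/
def eoptD {d : ℕ} (α ℓ : Fin d → ℝ) (X : Finset (Fin d → ℝ)) : ℝ :=
  ⨅ w : (Fin d → ℝ) → ℝ, wceD α ℓ fun f => ∑ y ∈ X, w y * f y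

/-- The point sets X_k = ∪_{m=1}^k (Y_{k−m+1}^{m,+} ∪ Y_{k−m+1}^{m,−}). -/
def Xk (Y : ℕ → Finset ℝ) (k : ℕ) : Finset ℝ :=
  (Finset.Icc 1 k).biUnion fun m =>
    ((Y (k - m + 1)).image fun x => x + (m : ℝ) - 1) ∪
      ((Y (k - m + 1)).image fun x => x - (m : ℝ))


theorem integrable_eval_mul_gaussian (p : Polynomial ℝ) :
    Integrable fun t : ℝ => p.eval t * Real.exp (-t ^ 2 / 2) := by
  induction p using Polynomial.induction_on' with
  | add p q hp hq =>
    simp only [Polynomial.eval_add, add_mul]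
    exact hp.add hq
  | monomial k a =>
    have h := (integrable_rpow_mul_exp_neg_mul_sq (b := 1 / 2) (by norm_num)
      (s := k) (by linarith [k.cast_nonneg (α := ℝ)])).const_mul a
    refine h.congr (ae_of_all _ fun t => ?_)
    simp only [Polynomial.eval_monomial, Real.rpow_natCast, mul_assoc]
    ring_nf

/-- Expectation of a polynomial under the standard Gaussian distribution. -/
def gaussExp (p : Polynomial ℝ) : ℝ :=
  (Real.sqrt (2 * Real.pi))⁻¹ * ∫ t : ℝ, p.eval t * Real.exp (-t ^ 2 / 2)

theorem gaussExp_sub (p q : Polynomial ℝ) : gaussExp (p - q) = gaussExp p - gaussExp q := by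
  simp only [gaussExp, Polynomial.eval_sub, sub_mul]
  rw [integral_sub (integrable_eval_mul_gaussian p) (integrable_eval_mul_gaussian q)]
  ring

theorem gaussExp_C (a : ℝ) : gaussExp (Polynomial.C a) = a := by
  have h : ∫ t : ℝ, Real.exp (-t ^ 2 / 2) = Real.sqrt (2 * Real.pi) := by
    have := integral_gaussian (1 / 2)
    rw [show Real.pi / (1 / 2) = 2 * Real.pi by ring] at this
    rw [← this]
    congr 1
    ext t
    ring_nf
  have : Real.sqrt (2 * Real.pi) ≠ 0 := by positivity
  simp only [gaussExp, Polynomial.eval_C, integral_const_mul, h]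
  field_simp

/-- Stein's identity. -/
theorem gaussExp_X_mul (p : Polynomial ℝ) :
    gaussExp (Polynomial.X * p) = gaussExp (Polynomial.derivative p) := by
  rw [← sub_eq_zero, ← gaussExp_sub, gaussExp]
  have hd (t : ℝ) : HasDerivAt (fun t => -(p.eval t * Real.exp (-t ^ 2 / 2)))
      ((Polynomial.X * p - Polynomial.derivative p).eval t * Real.exp (-t ^ 2 / 2)) t := by
    have h1 : HasDerivAt (fun t : ℝ => -t ^ 2 / 2) (-t) t := by
      convert! ((hasDerivAt_pow 2 t).neg.div_const 2) using 1
      simp only [Nat.cast_ofNat, Nat.add_one_sub_one, pow_one]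
      ring
    convert! ((p.hasDerivAt t).mul h1.exp).neg using 1
    simp only [Polynomial.eval_sub, Polynomial.eval_mul, Polynomial.eval_X]
    ring
  rw [integral_eq_zero_of_hasDerivAt_of_integrable hd (integrable_eval_mul_gaussian _)
    (integrable_eval_mul_gaussian p).neg, mul_zero]

theorem gaussExp_hermite_mul (n : ℕ) (r : Polynomial ℝ) :
    gaussExp ((Polynomial.hermite n).map (Int.castRingHom ℝ) * r) =
      gaussExp (Polynomial.derivative^[n] r) := by
  induction n generalizing r with
  | zero => simp
  | succ n ih =>
    rw [Function.iterate_succ_apply, ← ih, ← sub_eq_zero, ← gaussExp_sub]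
    set q := (Polynomial.hermite n).map (Int.castRingHom ℝ) with hq
    have : (Polynomial.hermite (n + 1)).map (Int.castRingHom ℝ) * r -
        q * Polynomial.derivative r =
        Polynomial.X * (q * r) - Polynomial.derivative (q * r) := by
      simp only [Polynomial.hermite_succ, Polynomial.map_sub, Polynomial.map_mul,
        Polynomial.map_X, ← Polynomial.derivative_map, ← hq, Polynomial.derivative_mul]
      ring
    rw [this, gaussExp_sub, gaussExp_X_mul, sub_self]

theorem monic_iterate_derivative {p : Polynomial ℝ} (hp : p.Monic) :
    Polynomial.derivative^[p.natDegree] p = Polynomial.C (p.natDegree.factorial : ℝ) := by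
  have h : (Polynomial.derivative^[p.natDegree] p).natDegree = 0 := by
    simpa using Polynomial.natDegree_iterate_derivative p p.natDegree
  rw [Polynomial.eq_C_of_natDegree_eq_zero h, Polynomial.coeff_iterate_derivative]
  simp [Nat.descFactorial_self, hp.coeff_natDegree]

theorem gaussExp_hermite_sq (n : ℕ) :
    gaussExp ((Polynomial.hermite n).map (Int.castRingHom ℝ) ^ 2) = n.factorial := by
  have hd : ((Polynomial.hermite n).map (Int.castRingHom ℝ)).natDegree = n := by
    rw [(Polynomial.hermite_monic n).natDegree_map, Polynomial.natDegree_hermite]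
  have := monic_iterate_derivative ((Polynomial.hermite_monic n).map (Int.castRingHom ℝ))
  rw [hd] at this
  rw [sq, gaussExp_hermite_mul, this, gaussExp_C]

/-- The error of the `n`-point Gauss–Hermite rule on the monomial of degree `2 * n`. -/
theorem IsGaussHermite.error_pow {n : ℕ} {x w : Fin n → ℝ} (h : IsGaussHermite n x w) :
    gaussExp (Polynomial.X ^ (2 * n)) - ∑ i, w i * x i ^ (2 * n) = n.factorial := by
  obtain ⟨-, hroot, -, hexact⟩ := h
  set H := (Polynomial.hermite n).map (Int.castRingHom ℝ)
  have hmon : H.Monic := (Polynomial.hermite_monic n).map _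
  have hd : (H ^ 2).natDegree = 2 * n := by
    rw [hmon.natDegree_pow, (Polynomial.hermite_monic n).natDegree_map,
      Polynomial.natDegree_hermite]
  have hlt : (Polynomial.X ^ (2 * n) - H ^ 2).natDegree ≤ 2 * n - 1 := by
    have hdeg : (Polynomial.X ^ (2 * n) - H ^ 2).degree < ((2 * n : ℕ) : WithBot ℕ) := by
      have := Polynomial.degree_sub_lt_left (p := (Polynomial.X ^ (2 * n) : Polynomial ℝ)) (q := H ^ 2)
        (by rw [Polynomial.degree_X_pow, Polynomial.degree_eq_natDegree (hmon.pow 2).ne_zero, hd])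
        (by simp) (by simp [(hmon.pow 2).leadingCoeff])
      rwa [Polynomial.degree_X_pow] at this
    rcases eq_or_ne (Polynomial.X ^ (2 * n) - H ^ 2) 0 with h0 | h0
    · simp [h0]
    · exact Nat.le_sub_one_of_lt ((Polynomial.natDegree_lt_iff_degree_lt h0).2 hdeg)
  have heval (i : Fin n) : H.eval (x i) = 0 := by
    have := hroot i
    rwa [Polynomial.aeval_def, ← Polynomial.eval_map] at this
  have key := hexact _ hlt
  change _ = gaussExp _ at key
  rw [gaussExp_sub, gaussExp_hermite_sq] at key
  simp only [Polynomial.eval_sub, Polynomial.eval_pow, Polynomial.eval_X, heval] at key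
  norm_num at key
  linarith

/-- Exactness of the Gauss–Hermite rule on constants. -/
theorem IsGaussHermite.sum_weights {n : ℕ} {x w : Fin n → ℝ} (h : IsGaussHermite n x w) :
    ∑ i, w i = 1 := by
  have := h.2.2.2 (Polynomial.C 1) (by simp)
  change _ = gaussExp _ at this
  simpa only [gaussExp_C, Polynomial.eval_C, mul_one] using this

theorem betaP_pos {α ℓ : ℝ} (hα : 0 < α) (hℓ : 0 < ℓ) : 0 < betaP α ℓ := by
  unfold betaP
  positivity

theorem betaP_sq {α ℓ : ℝ} (hα : 0 < α) (hℓ : 0 < ℓ) :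
    betaP α ℓ ^ 2 = α ^ 2 * ℓ ^ 2 / (α ^ 2 + ℓ ^ 2) := by
  rw [betaP, div_pow, Real.sq_sqrt (by positivity), mul_pow]

theorem integral_phi_mul_gaussian {α ℓ : ℝ} (hα : 0 < α) (hℓ : 0 < ℓ) (m : ℕ) :
    ∫ t : ℝ, phi ℓ m t *
        ((Real.sqrt (2 * Real.pi) * α)⁻¹ * Real.exp (-t ^ 2 / (2 * α ^ 2))) =
      betaP α ℓ / α * ((betaP α ℓ / ℓ) ^ m / Real.sqrt m.factorial) *
        gaussExp (Polynomial.X ^ m) := by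
  have hβ := betaP_pos hα hℓ
  have hβ2 := betaP_sq hα hℓ
  set β := betaP α ℓ
  have hsub := Measure.integral_comp_mul_left (fun t : ℝ => phi ℓ m t *
    ((Real.sqrt (2 * Real.pi) * α)⁻¹ * Real.exp (-t ^ 2 / (2 * α ^ 2)))) β
  rw [abs_of_pos (inv_pos.2 hβ), smul_eq_mul, eq_inv_mul_iff_mul_eq₀ hβ.ne'] at hsub
  have hexp (t : ℝ) : Real.exp (-(β * t) ^ 2 / (2 * ℓ ^ 2)) *
      Real.exp (-(β * t) ^ 2 / (2 * α ^ 2)) = Real.exp (-t ^ 2 / 2) := by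
    rw [← Real.exp_add, mul_pow, hβ2]
    congr 1
    field_simp
    ring
  rw [← hsub, gaussExp, ← mul_assoc, ← integral_const_mul, ← integral_const_mul]
  congr 1
  ext t
  rw [← hexp]
  simp only [phi, Polynomial.eval_pow, Polynomial.eval_X]
  rw [mul_pow, div_pow]
  field_simp

theorem scaled_weight_mul_phi (α ℓ : ℝ) (m : ℕ) (u v : ℝ) :
    betaP α ℓ / α * v * Real.exp (betaP α ℓ ^ 2 * u ^ 2 / (2 * ℓ ^ 2)) *
        phi ℓ m (betaP α ℓ * u) =
      betaP α ℓ / α * ((betaP α ℓ / ℓ) ^ m / Real.sqrt m.factorial) * (v * u ^ m) := by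
  have h : Real.exp (betaP α ℓ ^ 2 * u ^ 2 / (2 * ℓ ^ 2)) *
      Real.exp (-(betaP α ℓ * u) ^ 2 / (2 * ℓ ^ 2)) = 1 := by
    rw [← Real.exp_add, Real.exp_eq_one_iff]
    ring
  rw [phi, mul_pow, div_pow]
  linear_combination (betaP α ℓ / α * v * betaP α ℓ ^ m * u ^ m /
    (ℓ ^ m * Real.sqrt m.factorial)) * h

theorem IgaussD_prod {d : ℕ} (α : Fin d → ℝ) (f : Fin d → ℝ → ℝ) :
    IgaussD α (fun xv => ∏ j, f j (xv j)) =
      ∏ j, ∫ t : ℝ, f j t *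
        ((Real.sqrt (2 * Real.pi) * α j)⁻¹ * Real.exp (-t ^ 2 / (2 * α j ^ 2))) := by
  simp only [IgaussD, ← Finset.prod_mul_distrib]
  exact integral_fintype_prod_volume_eq_prod (fun j t => f j t *
        ((Real.sqrt (2 * Real.pi) * α j)⁻¹ * Real.exp (-t ^ 2 / (2 * α j ^ 2))))

theorem QGHD_prod {d : ℕ} (α ℓ : Fin d → ℝ) (n : Fin d → ℕ)
    (x w : ∀ j, Fin (n j) → ℝ) (f : Fin d → ℝ → ℝ) :
    QGHD α ℓ n x w (fun xv => ∏ j, f j (xv j)) =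
      ∏ j, ∑ k, betaP (α j) (ℓ j) / α j * w j k *
        Real.exp (betaP (α j) (ℓ j) ^ 2 * x j k ^ 2 / (2 * ℓ j ^ 2)) *
          f j (betaP (α j) (ℓ j) * x j k) := by
  simp only [QGHD, ← Finset.prod_mul_distrib, Finset.prod_univ_sum, Fintype.piFinset_univ]

/-- exact error of the tensor product scaled Gauss–Hermite rule on the function
f_i(x) = φ_{ℓ_i,2n_i}(x_i) ∏_{j≠i} φ_{ℓ_j,0}(x_j). -/
theorem stmt9 (d : ℕ) (hd : 0 < d) (α ℓ : Fin d → ℝ)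
    (hα : ∀ j, 0 < α j) (hℓ : ∀ j, 0 < ℓ j)
    (n : Fin d → ℕ) (hn : ∀ j, 1 ≤ n j)
    (x w : ∀ j, Fin (n j) → ℝ) (hGH : ∀ j, IsGaussHermite (n j) (x j) (w j))
    (i : Fin d) :
    IgaussD α (fun xv => phi (ℓ i) (2 * n i) (xv i) *
        ∏ j ∈ Finset.univ.erase i, phi (ℓ j) 0 (xv j)) -
      QGHD α ℓ n x w (fun xv => phi (ℓ i) (2 * n i) (xv i) *
        ∏ j ∈ Finset.univ.erase i, phi (ℓ j) 0 (xv j))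
      = Cseq (n i) * (∏ j, betaP (α j) (ℓ j) / α j) *
          (betaP (α i) (ℓ i) ^ 2 / (2 * ℓ i ^ 2)) ^ n i * (n i : ℝ) ^ ((1 : ℝ) / 4) := by
  set m : Fin d → ℕ := fun j => if j = i then 2 * n i else 0 with hm
  have hmi : m i = 2 * n i := by simp [hm]
  have hmj {j : Fin d} (hj : j ∈ Finset.univ.erase i) : m j = 0 := by
    simp [hm, Finset.ne_of_mem_erase hj]
  have hf : (fun xv : Fin d → ℝ => phi (ℓ i) (2 * n i) (xv i) *
      ∏ j ∈ Finset.univ.erase i, phi (ℓ j) 0 (xv j)) =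
      fun xv => ∏ j, phi (ℓ j) (m j) (xv j) := by
    ext xv
    rw [← Finset.mul_prod_erase _ _ (Finset.mem_univ i), hmi]
    congr 1
    exact Finset.prod_congr rfl fun j hj => by rw [hmj hj]
  rw [hf, IgaussD_prod α fun j => phi (ℓ j) (m j),
    QGHD_prod α ℓ n x w fun j => phi (ℓ j) (m j)]
  simp only [fun j => integral_phi_mul_gaussian (hα j) (hℓ j),
    scaled_weight_mul_phi, ← Finset.mul_sum]
  have h0 {j : Fin d} (hj : j ∈ Finset.univ.erase i) :
      gaussExp (Polynomial.X ^ m j) = 1 := by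
    rw [hmj hj, pow_zero, ← Polynomial.C_1, gaussExp_C]
  have h0' {j : Fin d} (hj : j ∈ Finset.univ.erase i) : ∑ k, w j k * x j k ^ m j = 1 := by
    simp [hmj hj, (hGH j).sum_weights]
  have h0c {j : Fin d} (hj : j ∈ Finset.univ.erase i) :
      (betaP (α j) (ℓ j) / ℓ j) ^ m j / Real.sqrt (m j).factorial = 1 := by
    simp [hmj hj]
  have hsplit (g : Fin d → ℝ) : ∏ j, g j = g i * ∏ j ∈ Finset.univ.erase i, g j :=
    (Finset.mul_prod_erase _ _ (Finset.mem_univ i)).symm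
  rw [hsplit, hsplit, hsplit fun j => betaP (α j) (ℓ j) / α j, hmi,
    Finset.prod_congr (g := fun j => betaP (α j) (ℓ j) / α j) rfl
      fun j hj => by rw [h0 hj, h0c hj, mul_one, mul_one],
    Finset.prod_congr (f := fun j => _ * ∑ k, _) (g := fun j => betaP (α j) (ℓ j) / α j) rfl
      fun j hj => by rw [h0' hj, h0c hj, mul_one, mul_one]]
  have hkey := (hGH i).error_pow
  have hnpos : (0 : ℝ) < n i := by exact_mod_cast hn i
  have hn4 : (n i : ℝ) ^ (-(1 / 4 : ℝ)) * (n i : ℝ) ^ ((1 : ℝ) / 4) = 1 := by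
    rw [← Real.rpow_add hnpos]
    simp
  have hpow : (2 : ℝ) ^ n i * (betaP (α i) (ℓ i) ^ 2 / (2 * ℓ i ^ 2)) ^ n i =
      (betaP (α i) (ℓ i) / ℓ i) ^ (2 * n i) := by
    rw [← mul_pow, pow_mul]
    congr 1
    field_simp
  rw [Cseq]
  generalize ∏ j ∈ Finset.univ.erase i, betaP (α j) (ℓ j) / α j = P
  generalize (n i : ℝ) ^ (-(1 / 4 : ℝ)) = a at *
  generalize (n i : ℝ) ^ ((1 : ℝ) / 4) = b at *
  generalize (betaP (α i) (ℓ i) ^ 2 / (2 * ℓ i ^ 2)) ^ n i = c at *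
  generalize (betaP (α i) (ℓ i) / ℓ i) ^ (2 * n i) = e at *
  subst hpow
  linear_combination (betaP (α i) (ℓ i) / α i * P * (2 ^ n i * c) /
    Real.sqrt (2 * n i).factorial) * (hkey - (n i).factorial * hn4)

end
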